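/- Non-computability of the output count: the function that maps k ≥ 1 to the number of distinct nonempty binary strings s with m_k(s) > 0 is not computable. -/

import Mathlib

/-- An instruction of a Busy Beaver machine: `Sum.inl b` means "write `b` and move to the
halting state (no head movement)"; `Sum.inr (q, b, d)` means "write `b`, move the head in
direction `d` (`true` = right, `false` = left) and change to state `q`".  For the class
`(n,2)` there are `4 * n + 2` instructions. -/
abbrev Instr (n : ℕ) := Bool ⊕ (Fin n × Bool × Bool)

/-- A Turing machine in the class `(n,2)`: a transition table assigning an instruction to
every pair (current state, read symbol). -/
abbrev Machine (n : ℕ) := (Fin n × Bool) → Instr n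

/-- A configuration: current state (`none` = halted), tape contents, head position, and the
interval `[lo, hi]` of cells visited so far by the head. -/
structure Config (n : ℕ) where
  state : Option (Fin n)
  tape : ℤ → Bool
  pos : ℤ
  lo : ℤ
  hi : ℤ

/-- One computation step. -/
def step {n : ℕ} (M : Machine n) (c : Config n) : Config n :=
  match c.state with
  | none => c
  | some q =>
    match M (q, c.tape c.pos) with
    | Sum.inl b => { c with state := none, tape := Function.update c.tape c.pos b }
    | Sum.inr (q', b, d) =>
      let p := c.pos + (if d then 1 else -1)
      { state := some q', tape := Function.update c.tape c.pos b,
        pos := p, lo := min c.lo p, hi := max c.hi p }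

/-- The initial configuration on a tape uniformly filled with the blank symbol `i`,
started in the initial state (state `⟨0, _⟩`, i.e. state "1" of `{1,…,n}`). -/
def initConfig (n : ℕ) (i : Bool) : Config n :=
  { state := if h : 0 < n then some ⟨0, h⟩ else none,
    tape := fun _ => i, pos := 0, lo := 0, hi := 0 }

/-- The configuration after `t` steps of the run `τ(i)`. -/
def cfgAt {n : ℕ} (M : Machine n) (i : Bool) (t : ℕ) : Config n :=
  (step M)^[t] (initConfig n i)

/-- A configuration is halted when the machine has entered the halting state. -/
def Halted {n : ℕ} (c : Config n) : Prop := c.state = none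

/-- The output read off a configuration: the symbols in the cells visited by the head. -/
def outputOf {n : ℕ} (c : Config n) : List Bool :=
  (List.range (c.hi - c.lo + 1).toNat).map fun j => c.tape (c.lo + j)

/-- `Outputs M i s` : the run `τ(i)` of `M` on blank symbol `i` halts with output `s`. -/
def Outputs {n : ℕ} (M : Machine n) (i : Bool) (s : List Bool) : Prop :=
  ∃ t, Halted (cfgAt M i t) ∧ outputOf (cfgAt M i t) = s

/-- `|{τ ∈ (n,2) : τ(i) = s}|`. -/
noncomputable def numOutput (n : ℕ) (i : Bool) (s : List Bool) : ℕ :=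
  Nat.card {τ : Machine n // Outputs τ i s}

/-- The exponent `n + 1 + ⌈log₂((4n+2)^(2n))⌉` (the length of the program encodings
with `n` states). -/
def expo (n : ℕ) : ℕ := n + 1 + Nat.clog 2 ((4 * n + 2) ^ (2 * n))

/-- The `n`-th term of the series defining `m(s)`. -/
noncomputable def mTerm (n : ℕ) (s : List Bool) : ℝ :=
  ((numOutput n false s + numOutput n true s : ℕ) : ℝ) / 2 ^ expo n

/-- The measure `m(s) = Σ_{n=1}^∞ (|{τ ∈ (n,2) : τ(0)=s}| + |{τ ∈ (n,2) : τ(1)=s}|) /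
2^(n+1+⌈log₂((4n+2)^(2n))⌉)`. -/
noncomputable def mDist (s : List Bool) : ℝ := ∑' j : ℕ, mTerm (j + 1) s

/-- The finite approximation `m_k(s)`: the same sum truncated to `1 ≤ n ≤ k`. -/
noncomputable def mApprox (k : ℕ) (s : List Bool) : ℝ :=
  ∑ n ∈ Finset.Icc 1 k, mTerm n s

/-- The finite approximation `m_k(s)` as a rational number. -/
noncomputable def mApproxQ (k : ℕ) (s : List Bool) : ℚ :=
  ∑ n ∈ Finset.Icc 1 k,
    ((numOutput n false s + numOutput n true s : ℕ) : ℚ) / 2 ^ expo n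

/-- The number of distinct nonempty strings `s` with `m_k(s) > 0`. -/
noncomputable def outputCount (k : ℕ) : ℕ :=
  Set.ncard {s : List Bool | s ≠ [] ∧ 0 < mApprox k s}

/-- A machine table listed row by row; the entry `(q, b, d)` at index `2 * p + a` describes the
instruction for state `p` reading `a`, where a state `q` out of range stands for halting. -/
abbrev Table := List (ℕ × Bool × Bool)

/-- The entry of a table for state `q` reading `a`. -/
def Table.entry (P : Table) (q : ℕ) (a : Bool) : ℕ × Bool × Bool :=
  P.getD (2 * q + a.toNat) (0, false, false)

/-- The instruction described by a table entry. -/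
def toInstr (n : ℕ) (e : ℕ × Bool × Bool) : Instr n :=
  if h : e.1 < n then Sum.inr (⟨e.1, h⟩, e.2.1, e.2.2) else Sum.inl e.2.1

/-- The table entry describing an instruction. -/
def ofInstr {n : ℕ} : Instr n → ℕ × Bool × Bool
  | Sum.inl b => (n, b, false)
  | Sum.inr (q, b, d) => (q, b, d)

theorem toInstr_ofInstr {n : ℕ} (x : Instr n) : toInstr n (ofInstr x) = x := by
  rcases x with b | ⟨q, b, d⟩ <;> simp [toInstr, ofInstr]

/-- The machine described by a table. -/
def Table.machine (P : Table) (n : ℕ) : Machine n := fun x => toInstr n (P.entry x.1 x.2)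

theorem exists_table {n : ℕ} (M : Machine n) : ∃ P : Table, P.machine n = M := by
  refine ⟨List.ofFn fun j : Fin (2 * n) =>
    ofInstr (M (⟨j / 2, by omega⟩, decide ((j : ℕ) % 2 = 1))), ?_⟩
  funext ⟨q, a⟩
  have hlt : 2 * (q : ℕ) + a.toNat < 2 * n := by
    have := q.2
    have := a.toNat_le
    omega
  have h1 : (2 * (q : ℕ) + a.toNat) / 2 = q := by
    have := a.toNat_lt
    omega
  have h2 : decide ((2 * (q : ℕ) + a.toNat) % 2 = 1) = a := by cases a <;> simp
  simp only [Table.machine, Table.entry, List.getD_eq_getElem?_getD]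
  rw [List.getElem?_ofFn, dif_pos hlt]
  simp only [Option.getD_some, h1, h2, toInstr_ofInstr]

/-- A configuration held by lists: the state (out of range if halted), the visited cells to the
left of the head from near to far, the scanned cell, and the visited cells to the right. -/
abbrev ListCfg := ℕ × List Bool × Bool × List Bool

/-- One step of a table on list configurations, with blank symbol `i`. -/
def listStep (n : ℕ) (i : Bool) (P : Table) (c : ListCfg) : ListCfg :=
  if c.1 < n then
    if (P.entry c.1 c.2.2.1).1 < n then
      if (P.entry c.1 c.2.2.1).2.2 = true then
        ((P.entry c.1 c.2.2.1).1, (P.entry c.1 c.2.2.1).2.1 :: c.2.1,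
          c.2.2.2.head?.getD i, c.2.2.2.tail)
      else
        ((P.entry c.1 c.2.2.1).1, c.2.1.tail,
          c.2.1.head?.getD i, (P.entry c.1 c.2.2.1).2.1 :: c.2.2.2)
    else (n, c.2.1, (P.entry c.1 c.2.2.1).2.1, c.2.2.2)
  else c

/-- The list configuration after `t` steps. -/
def listRun (n : ℕ) (i : Bool) (P : Table) (t : ℕ) : ListCfg :=
  (listStep n i P)^[t] (0, [], i, [])

/-- The output read off a list configuration. -/
def listOut (c : ListCfg) : List Bool := c.2.1.reverse ++ c.2.2.1 :: c.2.2.2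

/-- A list configuration represents a configuration on a tape with blank symbol `i`. -/
structure Represents {n : ℕ} (i : Bool) (c : Config n) (s : ListCfg) : Prop where
  state : c.state = if h : s.1 < n then some ⟨s.1, h⟩ else none
  lo : c.lo = c.pos - s.2.1.length
  hi : c.hi = c.pos + s.2.2.2.length
  head : c.tape c.pos = s.2.2.1
  left : ∀ j : ℕ, c.tape (c.pos - 1 - j) = s.2.1[j]?.getD i
  right : ∀ j : ℕ, c.tape (c.pos + 1 + j) = s.2.2.2[j]?.getD i

theorem Represents.step {n : ℕ} {i : Bool} {P : Table} {c : Config n} {s : ListCfg}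
    (h : Represents i c s) : Represents i (step (P.machine n) c) (listStep n i P s) := by
  obtain ⟨st, tape, pos, lo, hi⟩ := c
  obtain ⟨q, L, a, R⟩ := s
  obtain ⟨h1, h2, h3, h4, h5, h6⟩ := h
  simp only at h1 h2 h3 h4 h5 h6
  subst h1
  by_cases hq : q < n
  swap
  · constructor <;> simp [_root_.step, listStep, hq, h2, h3, h4, h5, h6]
  rcases he : P.entry q a with ⟨q', b, d⟩
  by_cases hq' : q' < n
  · cases d
    · constructor
      · simp [_root_.step, listStep, hq, h4, Table.machine, he, toInstr, hq']
      · simp only [_root_.step, listStep, hq, h4, Table.machine, he, toInstr, hq', dite_true]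
        cases L <;> simp_all
        all_goals omega
      · simp only [_root_.step, listStep, hq, h4, Table.machine, he, toInstr, hq', dite_true]
        cases L <;> simp_all
        all_goals omega
      · simp only [_root_.step, listStep, hq, h4, Table.machine, he, toInstr, hq', dite_true]
        have := h5 0
        cases L <;> simp_all [sub_eq_add_neg]
      · intro j
        simp only [_root_.step, listStep, hq, h4, Table.machine, he, toInstr, hq', dite_true]
        have := h5 (j + 1)
        rw [Function.update_of_ne (by simp; omega)]
        convert this using 2
        · push_cast; ring
        · simp
      · intro j
        simp only [_root_.step, listStep, hq, h4, Table.machine, he, toInstr, hq', dite_true]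
        rcases j with _ | j
        · simp
        · have := h6 j
          rw [Function.update_of_ne (by simp; omega)]
          simp only [Bool.false_eq_true, if_false, if_true, List.getElem?_cons_succ, ← this]
          congr 1
          push_cast; ring
    · constructor
      · simp [_root_.step, listStep, hq, h4, Table.machine, he, toInstr, hq']
      · simp only [_root_.step, listStep, hq, h4, Table.machine, he, toInstr, hq', dite_true]
        cases R <;> simp_all
        all_goals omega
      · simp only [_root_.step, listStep, hq, h4, Table.machine, he, toInstr, hq', dite_true]
        cases R <;> simp_all
        all_goals omega
      · simp only [_root_.step, listStep, hq, h4, Table.machine, he, toInstr, hq', dite_true]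
        have := h6 0
        cases R <;> simp_all
      · intro j
        simp only [_root_.step, listStep, hq, h4, Table.machine, he, toInstr, hq', dite_true]
        rcases j with _ | j
        · simp
        · have := h5 j
          rw [Function.update_of_ne (by simp; omega)]
          simp only [if_true, List.getElem?_cons_succ, ← this]
          congr 1
          push_cast; ring
      · intro j
        simp only [_root_.step, listStep, hq, h4, Table.machine, he, toInstr, hq', dite_true]
        have := h6 (j + 1)
        rw [Function.update_of_ne (by simp; omega)]
        convert this using 2
        · push_cast; ring
        · simp
  · constructor <;> simp only [_root_.step, listStep, hq, h4, Table.machine, he, toInstr, hq',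
      dite_true, dite_false, if_true, if_false, lt_irrefl, h2, h3, Function.update_self]
    · intro j
      rw [Function.update_of_ne (by omega), h5]
    · intro j
      rw [Function.update_of_ne (by omega), h6]

theorem represents_cfgAt {n : ℕ} (i : Bool) (P : Table) (t : ℕ) :
    Represents i (cfgAt (P.machine n) i t) (listRun n i P t) := by
  induction t with
  | zero => exact ⟨rfl, by simp [cfgAt, initConfig, listRun], by simp [cfgAt, initConfig, listRun],
      rfl, by simp [cfgAt, initConfig, listRun], by simp [cfgAt, initConfig, listRun]⟩
  | succ t ih =>
    rw [cfgAt, listRun, Function.iterate_succ_apply', Function.iterate_succ_apply']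
    exact ih.step

theorem outputOf_eq_map {n : ℕ} (c : Config n) : outputOf c =
    (List.range (c.hi - c.lo + 1).toNat).map fun j : ℕ => c.tape (c.lo + j) := by
  simp [outputOf, ← List.map_eq_flatMap]

theorem Represents.outputOf_eq {n : ℕ} {i : Bool} {c : Config n} {s : ListCfg}
    (h : Represents i c s) : outputOf c = listOut s := by
  obtain ⟨q, L, a, R⟩ := s
  obtain ⟨-, h2, h3, h4, h5, h6⟩ := h
  simp only at h2 h3 h4 h5 h6
  have hlen : (c.hi - c.lo + 1).toNat = L.length + 1 + R.length := by omega
  refine List.ext_getElem (by simp [outputOf_eq_map, listOut, hlen]; omega) fun j hj _ => ?_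
  simp only [outputOf_eq_map, hlen, List.length_map, List.length_range] at hj
  simp only [outputOf_eq_map, listOut, List.getElem_map, List.getElem_range]
  rcases lt_trichotomy j L.length with hjl | rfl | hjl
  · rw [List.getElem_append_left (by simpa), List.getElem_reverse]
    have := h5 (L.length - 1 - j)
    rw [List.getElem?_eq_getElem (by omega), Option.getD_some] at this
    rw [← this]
    congr 1
    omega
  · rw [List.getElem_append_right (by simp)]
    simp only [List.length_reverse, Nat.sub_self, List.getElem_cons_zero, ← h4]
    congr 1
    omega
  · rw [List.getElem_append_right (by simp; omega)]
    obtain ⟨m, rfl⟩ : ∃ m, j = L.length + 1 + m := ⟨j - L.length - 1, by omega⟩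
    have hm : L.length + 1 + m - L.reverse.length = m + 1 := by simp; omega
    have := h6 m
    rw [List.getElem?_eq_getElem (by omega), Option.getD_some] at this
    simp only [hm, List.getElem_cons_succ, ← this]
    congr 1
    omega

theorem Represents.halted_iff {n : ℕ} {i : Bool} {c : Config n} {s : ListCfg}
    (h : Represents i c s) : Halted c ↔ n ≤ s.1 := by
  rw [Halted, h.state]
  by_cases hs : s.1 < n <;> simp [hs]; omega

theorem outputs_machine_iff {n : ℕ} (P : Table) (i : Bool) (s : List Bool) :
    Outputs (P.machine n) i s ↔
      ∃ t, n ≤ (listRun n i P t).1 ∧ listOut (listRun n i P t) = s := by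
  simp only [Outputs, (represents_cfgAt i P _).halted_iff, (represents_cfgAt i P _).outputOf_eq]

/-- A nonblank cell at distance `d` to the right of the head forces `d` to be less than the
length of the output. -/
theorem lt_length_outputOf {n : ℕ} (M : Machine n) (i : Bool) (t d : ℕ)
    (hd : (cfgAt M i t).tape ((cfgAt M i t).pos + d) ≠ i) :
    d < (outputOf (cfgAt M i t)).length := by
  obtain ⟨P, rfl⟩ := exists_table M
  have h := represents_cfgAt (n := n) i P t
  rw [h.outputOf_eq]
  rcases d with _ | d
  · simp [listOut]
  · have h6 := h.right d
    rw [show (cfgAt (P.machine n) i t).pos + 1 + d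
      = (cfgAt (P.machine n) i t).pos + (d + 1 : ℕ) by push_cast; ring] at h6
    rw [h6] at hd
    have : d < (listRun n i P t).2.2.2.length := by
      by_contra hc
      rw [List.getElem?_eq_none (by omega)] at hd
      exact hd rfl
    simp [listOut]
    omega

theorem Outputs.unique {n : ℕ} {M : Machine n} {i : Bool} {s s' : List Bool}
    (h : Outputs M i s) (h' : Outputs M i s') : s = s' := by
  obtain ⟨t, ht, rfl⟩ := h
  obtain ⟨t', ht', rfl⟩ := h'
  have key : ∀ t, Halted (cfgAt M i t) → ∀ u, cfgAt M i (t + u) = cfgAt M i t := by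
    intro t ht u
    induction u with
    | zero => rfl
    | succ u ih =>
      rw [← Nat.add_assoc, cfgAt, Function.iterate_succ_apply', ← cfgAt, ih, step, ht]
  rw [← key t ht t', ← key t' ht' t, Nat.add_comm]

theorem Outputs.ne_nil {n : ℕ} {M : Machine n} {i : Bool} {s : List Bool}
    (h : Outputs M i s) : s ≠ [] := by
  obtain ⟨P, rfl⟩ := exists_table M
  obtain ⟨t, -, rfl⟩ := (outputs_machine_iff P i s).1 h
  simp [listOut]

theorem numOutput_ne_zero_iff {n : ℕ} {i : Bool} {s : List Bool} :
    numOutput n i s ≠ 0 ↔ ∃ M : Machine n, Outputs M i s := by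
  rw [numOutput, Nat.card_ne_zero, nonempty_subtype, and_iff_left (Subtype.finite)]

theorem mApprox_pos_iff {k : ℕ} {s : List Bool} : 0 < mApprox k s ↔
    ∃ n, (1 ≤ n ∧ n ≤ k) ∧ ∃ (M : Machine n) (i : Bool), Outputs M i s := by
  have hterm (n : ℕ) : 0 < mTerm n s ↔ ∃ (M : Machine n) (i : Bool), Outputs M i s := by
    rw [mTerm, div_pos_iff_of_pos_right (by positivity), Nat.cast_pos, Nat.add_pos_iff_pos_or_pos,
      Nat.pos_iff_ne_zero, Nat.pos_iff_ne_zero, numOutput_ne_zero_iff, numOutput_ne_zero_iff,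
      ← exists_or]
    simp
  rw [mApprox, Finset.sum_pos_iff_of_nonneg fun n _ => by unfold mTerm; positivity]
  simp only [hterm, Finset.mem_Icc]

/-- The strings output by some machine with between `1` and `k` states. -/
def outputSet (k : ℕ) : Set (List Bool) :=
  {s | ∃ n, (1 ≤ n ∧ n ≤ k) ∧ ∃ (M : Machine n) (i : Bool), Outputs M i s}

theorem outputCount_eq (k : ℕ) : outputCount k = (outputSet k).ncard := by
  rw [outputCount]
  congr 1
  ext s
  simp only [Set.mem_ofPred_eq, mApprox_pos_iff, outputSet, and_iff_right_iff_imp]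
  rintro ⟨n, -, M, i, h⟩
  exact h.ne_nil

theorem finite_outputSet (k : ℕ) : (outputSet k).Finite := by
  have : outputSet k = ⋃ n ∈ Set.Icc 1 k, ⋃ (M : Machine n) (i : Bool), {s | Outputs M i s} := by
    ext s
    simp [outputSet]
  rw [this]
  refine (Set.finite_Icc 1 k).biUnion fun n _ => Set.finite_iUnion fun M =>
    Set.finite_iUnion fun i => Set.Subsingleton.finite fun s hs s' hs' => hs.unique hs'

theorem primrec_entry : Primrec fun x : Table × ℕ × Bool => x.1.entry x.2.1 x.2.2 := by
  refine (Primrec.list_getD (0, false, false)).comp .fst (Primrec.nat_add.comp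
    (Primrec.nat_mul.comp (.const 2) (.comp .fst .snd)) ?_)
  exact (Primrec.dom_finite Bool.toNat).comp (.comp .snd .snd)

theorem primrec_listStep :
    Primrec₂ fun (x : Table × ℕ × Bool) (c : ListCfg) => listStep x.2.1 x.2.2 x.1 c := by
  have hn : Primrec fun y : (Table × ℕ × Bool) × ListCfg => y.1.2.1 := .comp .fst (.comp .snd .fst)
  have hi : Primrec fun y : (Table × ℕ × Bool) × ListCfg => y.1.2.2 := .comp .snd (.comp .snd .fst)
  have hq : Primrec fun y : (Table × ℕ × Bool) × ListCfg => y.2.1 := .comp .fst .snd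
  have hL : Primrec fun y : (Table × ℕ × Bool) × ListCfg => y.2.2.1 := .comp .fst (.comp .snd .snd)
  have ha : Primrec fun y : (Table × ℕ × Bool) × ListCfg => y.2.2.2.1 :=
    .comp .fst (.comp .snd (.comp .snd .snd))
  have hR : Primrec fun y : (Table × ℕ × Bool) × ListCfg => y.2.2.2.2 :=
    .comp .snd (.comp .snd (.comp .snd .snd))
  have he : Primrec fun y : (Table × ℕ × Bool) × ListCfg => y.1.1.entry y.2.1 y.2.2.2.1 :=
    primrec_entry.comp (.pair (.comp .fst .fst) (.pair hq ha))
  have hb := Primrec.fst.comp (Primrec.snd.comp he)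
  have hd := Primrec.snd.comp (Primrec.snd.comp he)
  refine Primrec.ite (Primrec.nat_lt.comp hq hn) (Primrec.ite
    (Primrec.nat_lt.comp (Primrec.fst.comp he) hn) (Primrec.ite
      (Primrec.eq.comp hd (.const true)) ?_ ?_) ?_) .snd
  · exact .pair (.comp .fst he) (.pair (Primrec.list_cons.comp hb hL)
      (.pair (Primrec.option_getD.comp (Primrec.list_head?.comp hR) hi)
        (Primrec.list_tail.comp hR)))
  · exact .pair (.comp .fst he) (.pair (Primrec.list_tail.comp hL)
      (.pair (Primrec.option_getD.comp (Primrec.list_head?.comp hL) hi)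
        (Primrec.list_cons.comp hb hR)))
  · exact .pair hn (.pair hL (.pair hb hR))

/-- A table, a number of states, a blank symbol and a number of steps. -/
abbrev RunSpec := Table × ℕ × Bool × ℕ

/-- The list configuration reached by the specified run. -/
def RunSpec.final (w : RunSpec) : ListCfg := listRun w.2.1 w.2.2.1 w.1 w.2.2.2

theorem primrec_final : Primrec RunSpec.final := by
  have hx : Primrec fun w : RunSpec => (w.1, w.2.1, w.2.2.1) :=
    .pair .fst (.pair (.comp .fst .snd) (.comp .fst (.comp .snd .snd)))
  exact Primrec.nat_iterate (.comp .snd (.comp .snd .snd)) (.pair (.const 0) (.pair (.const [])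
    (.pair (.comp .fst (.comp .snd .snd)) (.const []))))
    (primrec_listStep.comp (hx.comp .fst) .snd)

theorem primrec_listOut : Primrec listOut :=
  Primrec.list_append.comp (Primrec.list_reverse.comp (.comp .fst .snd)) <|
    Primrec.list_cons.comp (.comp .fst (.comp .snd .snd)) (.comp .snd (.comp .snd .snd))

/-- The specified run belongs to a machine with between `1` and `k` states and has halted. -/
def RunSpec.Valid (w : RunSpec) (k : ℕ) : Prop := (1 ≤ w.2.1 ∧ w.2.1 ≤ k) ∧ w.2.1 ≤ w.final.1

theorem primrecRel_valid : PrimrecRel RunSpec.Valid := by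
  have hn : Primrec fun x : RunSpec × ℕ => x.1.2.1 := .comp .fst (.comp .snd .fst)
  exact ((Primrec.nat_le.comp (.const 1) hn).and (Primrec.nat_le.comp hn .snd)).and
    (Primrec.nat_le.comp hn (.comp .fst (primrec_final.comp .fst)))

theorem nodup_iff_idxOf {α : Type*} [DecidableEq α] (d : α) (L : List α) :
    L.Nodup ↔ ∀ i < L.length, L.idxOf (L.getD i d) = i := by
  constructor
  · intro h i hi
    rw [List.getD_eq_getElem _ _ hi, h.idxOf_getElem]
  · intro h
    rw [List.nodup_iff_injective_getElem]
    rintro ⟨i, hi⟩ ⟨j, hj⟩ hij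
    have h1 := h i hi
    have h2 := h j hj
    rw [List.getD_eq_getElem _ _ ‹_›] at h1 h2
    simp only at hij
    rw [hij] at h1
    exact Fin.ext (h1.symm.trans h2)

theorem primrecPred_nodup {α : Type*} [Primcodable α] [DecidableEq α] [Inhabited α] :
    PrimrecPred (List.Nodup (α := α)) := by
  have : PrimrecRel fun (i : ℕ) (L : List α) => L.idxOf (L.getD i default) = i :=
    Primrec.eq.comp (Primrec.list_idxOf.comp ((Primrec.list_getD default).comp .snd .fst) .snd) .fst
  have h : PrimrecPred fun L : List α => ∀ i < L.length, L.idxOf (L.getD i default) = i :=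
    (this.forall_mem_list.comp (Primrec.list_range.comp Primrec.list_length) .id).of_eq
      fun L => by simp
  exact h.of_eq fun L => (nodup_iff_idxOf default L).symm

/-- The specified runs certify that `m` distinct strings are output by machines with at most `k`
states. -/
def Certifies (W : List RunSpec) (x : ℕ × ℕ) : Prop :=
  ((∀ w ∈ W, w.Valid x.1) ∧ (W.map fun w => listOut w.final).Nodup) ∧ W.length = x.2

theorem primrecRel_certifies : PrimrecRel Certifies :=
  ((primrecRel_valid.forall_mem_list.comp .fst (.comp .fst .snd)).and
    (primrecPred_nodup.comp (Primrec.list_map .fst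
      ((primrec_listOut.comp primrec_final).comp .snd).to₂))).and
    (Primrec.eq.comp (Primrec.list_length.comp .fst) (.comp .snd .snd))

theorem Certifies.map_eq_outputSet {k : ℕ} {W : List RunSpec}
    (h : Certifies W (k, outputCount k)) :
    ((W.map fun w => listOut w.final).toFinset : Set (List Bool)) = outputSet k := by
  obtain ⟨⟨h1, h2⟩, h3⟩ := h
  refine Set.eq_of_subset_of_ncard_le ?_ ?_ (finite_outputSet k)
  · intro s hs
    simp only [List.coe_toFinset, List.mem_map, Set.mem_ofPred_eq] at hs
    obtain ⟨w, hw, rfl⟩ := hs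
    obtain ⟨hk, ht⟩ := h1 w hw
    exact ⟨w.2.1, hk, w.1.machine _, w.2.2.1, (outputs_machine_iff _ _ _).2 ⟨_, ht, rfl⟩⟩
  · rw [← outputCount_eq, Set.ncard_coe_finset, List.toFinset_card_of_nodup h2, List.length_map, h3]

theorem exists_certifies (k : ℕ) : ∃ W, Certifies W (k, outputCount k) := by
  have (s : List Bool) (hs : s ∈ outputSet k) :
      ∃ w : RunSpec, w.Valid k ∧ listOut w.final = s := by
    obtain ⟨n, hn, M, i, h⟩ := hs
    obtain ⟨P, rfl⟩ := exists_table M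
    obtain ⟨t, ht, rfl⟩ := (outputs_machine_iff _ _ _).1 h
    exact ⟨(P, n, i, t), ⟨hn, ht⟩, rfl⟩
  choose! w hw hout using this
  have hmem (s) : s ∈ (finite_outputSet k).toFinset.toList ↔ s ∈ outputSet k := by simp
  refine ⟨(finite_outputSet k).toFinset.toList.map w, ⟨?_, ?_⟩, ?_⟩
  · simp only [List.mem_map, hmem]
    rintro _ ⟨s, hs, rfl⟩
    exact hw s hs
  · rw [List.map_map, List.map_congr_left (g := id), List.map_id]
    · exact Finset.nodup_toList _
    · intro s hs
      exact hout s ((hmem s).1 hs)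
  · rw [List.length_map, Finset.length_toList, outputCount_eq,
      Set.ncard_eq_toFinset_card _ (finite_outputSet k)]

/-- If the output count were computable, the lengths of outputs would have a computable bound. -/
theorem exists_computable_bound {f : ℕ → ℕ} (hf : Computable f)
    (hfk : ∀ k, 1 ≤ k → f k = outputCount k) :
    ∃ g : ℕ → ℕ, Computable g ∧ ∀ k, ∀ n, 1 ≤ n → n ≤ k → ∀ (M : Machine n) (i : Bool)
      (s : List Bool), Outputs M i s → s.length ≤ g k := by
  obtain ⟨C, hCp, hC⟩ : ∃ C : List RunSpec → ℕ × ℕ → Bool, Primrec₂ C ∧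
      ∀ W x, C W x = true ↔ Certifies W x := by
    obtain ⟨hdec, hcert⟩ := primrecRel_certifies
    exact ⟨fun W x => @decide _ (hdec (W, x)), hcert, fun W x => by simp⟩
  let F (k j : ℕ) : Option ℕ := (Encodable.decode (α := List RunSpec) j).bind fun W =>
    bif C W (k + 1, f (k + 1)) then
      some (W.flatMap fun w => listOut w.final).length else none
  have hlen : Primrec fun W : List RunSpec => (W.flatMap fun w => listOut w.final).length :=
    Primrec.list_length.comp (Primrec.list_flatMap .id
      ((primrec_listOut.comp primrec_final).comp .snd))
  have hF : Computable₂ F := by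
    refine Computable.option_bind (Primrec.decode.to_comp.comp .snd) ?_
    refine Computable.cond (Computable₂.comp hCp.to_comp .snd (.pair ?_ ?_))
      (Computable.option_some.comp (hlen.to_comp.comp .snd)) (.const none)
    · exact Computable.succ.comp (.comp .fst .fst)
    · exact hf.comp (Computable.succ.comp (.comp .fst .fst))
  have hdom (k : ℕ) : (Nat.rfindOpt (F k)).Dom := by
    obtain ⟨W, hW⟩ := exists_certifies (k + 1)
    rw [← hfk _ (Nat.le_add_left 1 k), ← hC] at hW
    exact Nat.rfindOpt_dom.2 ⟨Encodable.encode W, _, by simp [F, hW]; rfl⟩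
  refine ⟨fun k => (Nat.rfindOpt (F k)).get (hdom k),
    (Partrec.rfindOpt hF).of_eq_tot fun k => Part.get_mem _, fun k n h1 hnk M i s hs => ?_⟩
  obtain ⟨j, hj⟩ := Nat.rfindOpt_spec (Part.get_mem (hdom k))
  simp only [F, Option.mem_def, Option.bind_eq_some_iff] at hj
  obtain ⟨W, -, hW⟩ := hj
  cases hc : C W (k + 1, f (k + 1))
  · simp [hc] at hW
  · rw [hc, cond_true, Option.some_inj] at hW
    refine le_of_le_of_eq ?_ hW
    rw [hC, hfk _ (Nat.le_add_left 1 k)] at hc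
    have hmem : s ∈ outputSet (k + 1) := ⟨n, ⟨h1, by omega⟩, M, i, hs⟩
    rw [← hc.map_eq_outputSet] at hmem
    simp only [List.coe_toFinset, List.mem_map, Set.mem_ofPred_eq] at hmem
    obtain ⟨w, hw, rfl⟩ := hmem
    rw [List.length_flatMap]
    exact List.le_sum_of_mem (List.mem_map.2 ⟨w, hw, rfl⟩)

/-- The machine given by an instruction table on a state type `Q` enumerated by `e`. -/
def enumMachine {Q : Type*} {n : ℕ} (e : Q ≃ Fin n) (δ : Q → Bool → Bool ⊕ (Q × Bool × Bool)) :
    Machine n :=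
  fun x => (δ (e.symm x.1) x.2).map id (Prod.map e id)

/-- A configuration is in a given state (of an enumerated type) and shows a given tape, centred at
the head. -/
def Shows {Q : Type*} {n : ℕ} (e : Q ≃ Fin n) (c : Config n) (q : Q) (T : Turing.Tape Bool) :
    Prop :=
  c.state = some (e q) ∧ ∀ j, c.tape (c.pos + j) = T.nth j

theorem Shows.moveStep {Q : Type*} {n : ℕ} {e : Q ≃ Fin n}
    {δ : Q → Bool → Bool ⊕ (Q × Bool × Bool)} {c : Config n} {q q' : Q} {T : Turing.Tape Bool}
    {b d : Bool} (h : Shows e c q T) (hδ : δ q T.head = Sum.inr (q', b, d)) :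
    Shows e (step (enumMachine e δ) c) q'
      ((T.write b).move (if d then Turing.Dir.right else Turing.Dir.left)) := by
  obtain ⟨h1, h2⟩ := h
  have hhead : c.tape c.pos = T.head := by simpa using h2 0
  have hM : enumMachine e δ (e q, T.head) = Sum.inr (e q', b, d) := by
    simp [enumMachine, hδ]
  have hw (j : ℤ) : Function.update c.tape c.pos b (c.pos + j) = (T.write b).nth j := by
    rw [Turing.Tape.write_nth, Function.update_apply, h2]
    simp
  simp only [Shows, step, h1, hhead, hM]
  refine ⟨trivial, fun j => ?_⟩
  cases d
  · simp only [Bool.false_eq_true, if_false, Turing.Tape.move_left_nth, ← hw]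
    congr 1
    ring
  · simp only [if_true, Turing.Tape.move_right_nth, ← hw]
    congr 1
    ring

theorem Shows.haltStep {Q : Type*} {n : ℕ} {e : Q ≃ Fin n}
    {δ : Q → Bool → Bool ⊕ (Q × Bool × Bool)} {c : Config n} {q : Q} {T : Turing.Tape Bool}
    (h : Shows e c q T) (hδ : δ q T.head = Sum.inl T.head) :
    Halted (step (enumMachine e δ) c) ∧ ∀ j,
      (step (enumMachine e δ) c).tape ((step (enumMachine e δ) c).pos + j) = T.nth j := by
  obtain ⟨h1, h2⟩ := h
  have hhead : c.tape c.pos = T.head := by simpa using h2 0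
  have hM : enumMachine e δ (e q, T.head) = Sum.inl T.head := by
    simp [enumMachine, hδ]
  simp only [Halted, step, h1, hhead, hM]
  refine ⟨trivial, fun j => ?_⟩
  rw [← hhead, Function.update_eq_self, h2]

/-- The table of a machine that writes the word `l`, from right to left, and then simulates the
Post-Turing machine `M` with states in `S`.  A writing step of `M` is followed by a move to the
right, which the states marked `true` undo. -/
def writeThenSimulate {Λ : Type*} [Inhabited Λ] [DecidableEq Λ] (M : Turing.TM0.Machine Bool Λ)
    (S : Finset Λ) (hS : default ∈ S) (l : List Bool) :
    Fin (l.length + 1) ⊕ (S × Bool) → Bool →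
      Bool ⊕ ((Fin (l.length + 1) ⊕ (S × Bool)) × Bool × Bool) :=
  let toS (q : Λ) : S := if h : q ∈ S then ⟨q, h⟩ else ⟨default, hS⟩
  fun q a => match q with
  | Sum.inl i =>
    if h : (i : ℕ) < l.length then
      Sum.inr (Sum.inl ⟨i + 1, by omega⟩, l[l.length - 1 - i], false)
    else Sum.inr (Sum.inr (toS default, false), a, true)
  | Sum.inr (q, true) => Sum.inr (Sum.inr (q, false), a, false)
  | Sum.inr (q, false) =>
    match M q a with
    | none => Sum.inl a
    | some (q', Turing.TM0.Stmt.move Turing.Dir.left) => Sum.inr (Sum.inr (toS q', false), a, false)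
    | some (q', Turing.TM0.Stmt.move Turing.Dir.right) => Sum.inr (Sum.inr (toS q', false), a, true)
    | some (q', Turing.TM0.Stmt.write b) => Sum.inr (Sum.inr (toS q', true), b, true)

theorem Turing.Tape.write_move_left_mk₁ {Γ : Type*} [Inhabited Γ] (l : List Γ) (x : Γ) :
    ((Turing.Tape.mk₁ l).move Turing.Dir.left).write x = Turing.Tape.mk₁ (x :: l) := by
  simp only [Turing.Tape.mk₁, Turing.Tape.mk₂, Turing.Tape.mk', Turing.Tape.move,
    Turing.Tape.write, Turing.ListBlank.cons_head_tail]
  simp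

theorem Turing.Tape.nth_mk₁_nil {Γ : Type*} [Inhabited Γ] (j : ℤ) :
    (Turing.Tape.mk₁ ([] : List Γ)).nth j = default := by
  rcases j with (_ | j) | j <;>
    simp [Turing.Tape.mk₁, Turing.Tape.mk₂, Turing.Tape.mk', Turing.Tape.nth]

theorem exists_outputs_of_mem_eval {Λ : Type*} [Inhabited Λ] (M : Turing.TM0.Machine Bool Λ)
    (S : Finset Λ) (hS : Turing.TM0.Supports M (S : Set Λ)) (l : List Bool)
    {c : Turing.TM0.Cfg Bool Λ}
    (hc : c ∈ StateTransition.eval (Turing.TM0.step M) (Turing.TM0.init l)) {d : ℕ}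
    (hd : c.Tape.nth d = true) :
    ∃ (τ : Machine (l.length + 1 + 2 * S.card)) (s : List Bool),
      Outputs τ false s ∧ d < s.length := by
  classical
  let Q := Fin (l.length + 1) ⊕ (S × Bool)
  have hcard : Fintype.card Q = l.length + 1 + 2 * S.card := by
    simp [Q, Nat.mul_comm]
  obtain ⟨e, he⟩ : ∃ e : Q ≃ Fin (l.length + 1 + 2 * S.card), e (Sum.inl 0) = ⟨0, by omega⟩ := by
    let e := Fintype.equivFinOfCardEq hcard
    exact ⟨e.trans (Equiv.swap (e (Sum.inl 0)) ⟨0, by omega⟩), by simp⟩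
  have hdef : default ∈ S := hS.1
  let δ := writeThenSimulate M S hdef l
  have hwrite (i : ℕ) (hi : i < l.length + 1) : ∃ t, Shows e (cfgAt (enumMachine e δ) false t)
      (Sum.inl ⟨i, hi⟩) ((Turing.Tape.mk₁ (l.drop (l.length - i))).move Turing.Dir.left) := by
    induction i with
    | zero =>
      refine ⟨0, ?_, fun j => ?_⟩
      · simpa [cfgAt, initConfig] using he.symm
      · simp [cfgAt, initConfig, Turing.Tape.nth_mk₁_nil]
    | succ i ih =>
      obtain ⟨t, ht⟩ := ih (by omega)
      refine ⟨t + 1, ?_⟩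
      rw [cfgAt, Function.iterate_succ_apply', ← cfgAt]
      have hil : i < l.length := by omega
      have := ht.moveStep (δ := δ) (q' := Sum.inl ⟨i + 1, hi⟩) (b := l[l.length - 1 - i])
        (d := false)
        (by simp [δ, writeThenSimulate, hil])
      rwa [Turing.Tape.write_move_left_mk₁, show l.length - i = l.length - 1 - i + 1 by omega,
        List.getElem_cons_drop, Nat.sub_sub, Nat.add_comm 1 i] at this
  have hsim (c : Turing.TM0.Cfg Bool Λ)
      (hc : StateTransition.Reaches (Turing.TM0.step M) (Turing.TM0.init l) c) :
      ∃ (hq : c.q ∈ S) (t : ℕ),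
        Shows e (cfgAt (enumMachine e δ) false t) (Sum.inr (⟨c.q, hq⟩, false)) c.Tape := by
    induction hc with
    | refl =>
      obtain ⟨t, ht⟩ := hwrite l.length (by omega)
      refine ⟨hdef, t + 1, ?_⟩
      rw [cfgAt, Function.iterate_succ_apply', ← cfgAt]
      have := ht.moveStep (δ := δ) (q' := Sum.inr (⟨default, hdef⟩, false)) (d := true)
        (by simp [δ, writeThenSimulate, hdef]; rfl)
      simpa [Turing.TM0.init] using this
    | @tail c c' _ hcc' ih =>
      obtain ⟨hq, t, ht⟩ := ih
      have hq' := Turing.TM0.step_supports M hS hcc' hq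
      refine ⟨hq', ?_⟩
      obtain ⟨q, T⟩ := c
      obtain ⟨⟨q', a⟩, hM, rfl⟩ := Option.map_eq_some_iff.1 hcc'
      have hq'S : q' ∈ S := hq'
      rcases a with (_ | _) | b
      · refine ⟨t + 1, ?_⟩
        rw [cfgAt, Function.iterate_succ_apply', ← cfgAt]
        have := ht.moveStep (δ := δ) (q' := Sum.inr (⟨q', hq'⟩, false)) (b := T.head) (d := false)
          (by simp [δ, writeThenSimulate, hM]; exact dif_pos hq'S)
        simpa using this
      · refine ⟨t + 1, ?_⟩
        rw [cfgAt, Function.iterate_succ_apply', ← cfgAt]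
        have := ht.moveStep (δ := δ) (q' := Sum.inr (⟨q', hq'⟩, false)) (b := T.head) (d := true)
          (by simp [δ, writeThenSimulate, hM]; exact dif_pos hq'S)
        simpa using this
      · refine ⟨t + 1 + 1, ?_⟩
        rw [cfgAt, Function.iterate_succ_apply', Function.iterate_succ_apply', ← cfgAt]
        have := (ht.moveStep (δ := δ) (q' := Sum.inr (⟨q', hq'⟩, true)) (b := b) (d := true)
          (by simp [δ, writeThenSimulate, hM]; exact dif_pos hq'S)).moveStep (δ := δ)
          (q' := Sum.inr (⟨q', hq'⟩, false)) (d := false) (by simp only [δ, writeThenSimulate]; rfl)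
        simpa using this
  obtain ⟨hreach, hnone⟩ := StateTransition.mem_eval.1 hc
  obtain ⟨hq, t, ht⟩ := hsim c hreach
  obtain ⟨q, T⟩ := c
  have hM : M q T.head = none := by simpa [Turing.TM0.step] using hnone
  obtain ⟨h1, h2⟩ := ht.haltStep (δ := δ) (by simp [δ, writeThenSimulate, hM])
  have hstep : step (enumMachine e δ) (cfgAt (enumMachine e δ) false t)
      = cfgAt (enumMachine e δ) false (t + 1) := by
    rw [cfgAt, cfgAt, Function.iterate_succ_apply']
  rw [hstep] at h1 h2
  exact ⟨enumMachine e δ, _, ⟨t + 1, h1, rfl⟩, lt_length_outputOf _ _ _ _ (by simp [h2, hd])⟩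

theorem exists_true_flatMap {Γ : Type*} [Inhabited Γ] {w : ℕ} {f : Γ → List Bool}
    (hlen : ∀ a, (f a).length = w) (hf : ∀ a, a ≠ default → ∃ j, (f a).getI j = true)
    (l : List Γ) (p : ℕ) (hp : l.getI p ≠ default) :
    ∃ d, p ≤ d ∧ (l.flatMap f).getI d = true := by
  have hlt {a : Γ} {j : ℕ} (h : (f a).getI j = true) : j < (f a).length := by
    by_contra hc
    rw [List.getI_eq_default _ (not_lt.1 hc)] at h
    simp at h
  induction l generalizing p with
  | nil => simp at hp
  | cons a l ih =>
    cases p with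
    | zero =>
      obtain ⟨j, hj⟩ := hf a (by simpa using hp)
      refine ⟨j, j.zero_le, ?_⟩
      rw [List.flatMap_cons, List.getI_append _ _ _ (hlt hj), hj]
    | succ p =>
      obtain ⟨d, hd, hd'⟩ := ih p (by simpa using hp)
      obtain ⟨j, hj⟩ := hf _ hp
      have hw := hlt hj
      rw [hlen] at hw
      refine ⟨(f a).length + d, by rw [hlen]; omega, ?_⟩
      rw [List.flatMap_cons, List.getI_append_right _ _ _ (by omega), Nat.add_sub_cancel_left, hd']

/-- A TM1 machine over a finite alphabet can be replaced by a Post-Turing machine over the binary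
alphabet, with linearly longer inputs and nonblank cells at least as far from the head. -/
theorem exists_binary_TM0 {Γ Λ σ : Type} [Inhabited Γ] [Fintype Γ] [Inhabited Λ] [Inhabited σ]
    [Fintype σ] (M : Λ → Turing.TM1.Stmt Γ Λ σ) (S : Finset Λ) (hS : Turing.TM1.Supports M S) :
    ∃ (Λ₀ : Type) (_ : Inhabited Λ₀) (M₀ : Turing.TM0.Machine Bool Λ₀) (S₀ : Finset Λ₀) (w : ℕ),
      Turing.TM0.Supports M₀ (S₀ : Set Λ₀) ∧
      ∀ L, ∀ c ∈ StateTransition.eval (Turing.TM1.step M) (Turing.TM1.init L),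
        ∃ l : List Bool, l.length = w * L.length ∧
        ∃ c₀ ∈ StateTransition.eval (Turing.TM0.step M₀) (Turing.TM0.init l),
        ∀ p : ℕ, c.Tape.nth p ≠ default → ∃ d : ℕ, p ≤ d ∧ c₀.Tape.nth d = true := by
  obtain ⟨w, enc, dec, enc0, encdec⟩ := Turing.TM1to1.exists_enc_dec (Γ := Γ)
  refine ⟨_, inferInstance, Turing.TM1to0.tr (Turing.TM1to1.tr enc dec M),
    Turing.TM1to0.trStmts _ (Turing.TM1to1.trSupp M S), w,
    Turing.TM1to0.tr_supports _ (Turing.TM1to1.tr_supports enc dec M hS), fun L c hc => ?_⟩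
  refine ⟨L.flatMap fun a => (enc a).toList, by simp [List.length_flatMap, Nat.mul_comm], ?_⟩
  obtain ⟨c₁, rfl, hc₁⟩ := StateTransition.tr_eval
    (Turing.TM1to1.tr_respects dec M encdec (enc0 := enc0)) rfl hc
  obtain ⟨c₂, rfl, hc₂⟩ := StateTransition.tr_eval
    (Turing.TM1to0.tr_respects (Turing.TM1to1.tr enc dec M)) rfl hc₁
  refine ⟨Turing.TM1to0.trCfg _ (Turing.TM1to1.trCfg enc enc0 c), ?_, ?_⟩
  · convert hc₂ using 2
    simp only [Turing.TM1.init, Turing.TM1to1.trCfg, Turing.TM1to0.trCfg, Turing.TM0.init,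
      Turing.Tape.mk₁, Turing.Tape.mk₂, Turing.TM1to1.trTape_mk', Turing.TM1to1.trTape']
    rfl
  · intro p hp
    obtain ⟨q, v, T⟩ := c
    obtain ⟨L, R, rfl⟩ := T.exists_mk'
    induction R using Turing.ListBlank.induction_on with | _ R
    simp only [Turing.Tape.mk'_nth_nat, Turing.ListBlank.nth_mk] at hp
    simp only [Turing.TM1to1.trCfg, Turing.TM1to0.trCfg, Turing.TM1to1.trTape_mk',
      Turing.TM1to1.trTape', Turing.Tape.mk'_nth_nat, Turing.ListBlank.flatMap_mk,
      Turing.ListBlank.nth_mk]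
    refine exists_true_flatMap (w := w) (fun a => by simp) (fun a ha => ?_) R p hp
    by_contra hc
    push Not at hc
    refine ha (Function.LeftInverse.injective encdec ?_)
    rw [enc0]
    refine List.Vector.ext fun j => ?_
    have := hc j
    rw [List.getI_eq_getElem _ (by simp)] at this
    rw [List.Vector.get_replicate]
    simpa [List.Vector.get_eq_get_toList] using this

/-- The simulation of a TM2 machine by a TM1 machine leaves at least as many nonblank cells as
there are symbols on any given stack. -/
theorem exists_mem_eval_TM2to1 {K : Type} [DecidableEq K] {Γ : K → Type} {Λ σ : Type} [Inhabited Λ]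
    [Inhabited σ] (M : Λ → Turing.TM2.Stmt Γ Λ σ) (k : K) (L : List (Γ k))
    {c : Turing.TM2.Cfg Γ Λ σ}
    (hc : c ∈ StateTransition.eval (Turing.TM2.step M) (Turing.TM2.init k L)) :
    ∃ c₁ ∈ StateTransition.eval (Turing.TM1.step (Turing.TM2to1.tr M))
        (Turing.TM1.init (Turing.TM2to1.trInit k L)),
      ∀ k (p : ℕ), p < (c.stk k).length → c₁.Tape.nth p ≠ default := by
  obtain ⟨c₁, ⟨L', hL'⟩, hc₁⟩ := StateTransition.tr_eval (Turing.TM2to1.tr_respects M)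
    (Turing.TM2to1.trCfg_init k L) hc
  refine ⟨_, hc₁, fun k p hp hdef => ?_⟩
  rw [Turing.Tape.mk'_nth_nat] at hdef
  have h := Turing.TM2to1.stk_nth_val p (hL' k)
  rw [← Turing.TM2to1.addBottom_nth_snd, hdef, List.getElem?_eq_getElem (by simpa using hp)] at h
  exact absurd h.symm (by exact Option.some_ne_none _)

theorem Turing.TM2to1.length_trInit {K : Type*} [DecidableEq K] {Γ : K → Type*} (k : K)
    (L : List (Γ k)) : (trInit k L).length = L.length - 1 + 1 := by
  refine (List.length_cons ..).trans ?_
  rw [List.length_tail]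
  exact congrArg (· - 1 + 1) ((List.length_map _).trans List.length_reverse)

namespace Turing.PartrecToTM2

theorem length_trPosNum_le (p : PosNum) : (trPosNum p).length ≤ (p : ℕ) := by
  induction p with
  | one => simp [trPosNum]
  | bit0 p ih => have := p.to_nat_pos; simp [trPosNum]; omega
  | bit1 p ih => simp [trPosNum]; omega

theorem lt_two_pow_length_trPosNum (p : PosNum) : (p : ℕ) < 2 ^ (trPosNum p).length := by
  induction p with
  | one => simp [trPosNum]
  | bit0 p ih => simp [trPosNum, pow_succ]; omega
  | bit1 p ih => simp [trPosNum, pow_succ]; omega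

theorem length_trNat_le (n : ℕ) : (trNat n).length ≤ n := by
  have h : ((n : Num) : ℕ) = n := Num.to_of_nat n
  rw [trNat]
  cases hn : (n : Num) with
  | zero => simp [trNum]
  | pos p =>
    rw [hn] at h
    exact (length_trPosNum_le p).trans h.le

theorem lt_two_pow_length_trNat (n : ℕ) : n < 2 ^ (trNat n).length := by
  have h : ((n : Num) : ℕ) = n := Num.to_of_nat n
  rw [trNat]
  cases hn : (n : Num) with
  | zero => rw [hn] at h; simp [trNum, ← h]
  | pos p =>
    rw [hn] at h
    exact h.symm.le.trans_lt (lt_two_pow_length_trPosNum p)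

end Turing.PartrecToTM2

/-- A code evaluating a given computable function on singleton lists. -/
theorem exists_code_of_computable {f : ℕ → ℕ} (hf : Computable f) :
    ∃ c : Turing.ToPartrec.Code, ∀ n, c.eval [n] = pure [f n] := by
  obtain ⟨c, hc⟩ := Turing.ToPartrec.Code.exists_code (Nat.Partrec'.part_iff₁.2 hf)
  refine ⟨c, fun n => ?_⟩
  exact hc (n ::ᵥ List.Vector.nil)

/-- For each computable `h`, machines with linearly many states have outputs longer than `h n`. -/
theorem exists_long_output {h : ℕ → ℕ} (hh : Computable h) :
    ∃ a, ∀ n, ∃ N, 1 ≤ N ∧ N ≤ a * n + a ∧ ∃ (τ : Machine N) (s : List Bool),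
      Outputs τ false s ∧ h n < s.length := by
  have hpow : Computable fun n => 2 ^ h n :=
    ((Primrec₂.unpaired'.1 Nat.Primrec.pow).comp (.const 2) .id).to_comp.comp hh
  obtain ⟨c, hc⟩ := exists_code_of_computable hpow
  let _ : Inhabited Turing.PartrecToTM2.Λ' :=
    ⟨Turing.PartrecToTM2.trNormal c Turing.PartrecToTM2.Cont'.halt⟩
  have : Fintype Turing.PartrecToTM2.K' :=
    ⟨{.main, .rev, .aux, .stack}, fun k => by cases k <;> simp⟩
  obtain ⟨Λ₀, _, M₀, S₀, w, hS₀, hM₀⟩ := exists_binary_TM0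
    (Turing.TM2to1.tr Turing.PartrecToTM2.tr) _
    (Turing.TM2to1.tr_supports _ (Turing.PartrecToTM2.tr_supports c _))
  refine ⟨2 * w + 1 + 2 * S₀.card, fun n => ?_⟩
  have hinit : Turing.PartrecToTM2.init c [n] =
      Turing.TM2.init Turing.PartrecToTM2.K'.main (Turing.PartrecToTM2.trList [n]) := by
    simp only [Turing.PartrecToTM2.init, Turing.TM2.init]
    congr 1
    funext k
    cases k <;> rfl
  have heval : Turing.PartrecToTM2.halt [2 ^ h n] ∈ StateTransition.eval
      (Turing.TM2.step Turing.PartrecToTM2.tr)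
      (Turing.TM2.init Turing.PartrecToTM2.K'.main (Turing.PartrecToTM2.trList [n])) := by
    rw [← hinit, Turing.PartrecToTM2.tr_eval, hc]
    exact ⟨trivial, rfl⟩
  obtain ⟨c₁, hc₁, hc₁'⟩ := exists_mem_eval_TM2to1 _ _ _ heval
  obtain ⟨l, hl, c₀, hc₀, hc₀'⟩ := hM₀ _ _ hc₁
  obtain ⟨d, hd, hd'⟩ := hc₀' (h n) <| hc₁' Turing.PartrecToTM2.K'.main (h n) <| by
    have := (Nat.pow_lt_pow_iff_right (by decide)).1
      (Turing.PartrecToTM2.lt_two_pow_length_trNat (2 ^ h n))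
    simp [Turing.PartrecToTM2.halt, Turing.PartrecToTM2.trList]
    omega
  obtain ⟨τ, s, hs, hds⟩ := exists_outputs_of_mem_eval M₀ S₀ hS₀ l hc₀ hd'
  refine ⟨_, by omega, ?_, τ, s, hs, by omega⟩
  have hlen : (Turing.TM2to1.trInit (Γ := fun _ : Turing.PartrecToTM2.K' => Turing.PartrecToTM2.Γ')
      Turing.PartrecToTM2.K'.main (Turing.PartrecToTM2.trList [n])).length ≤ n + 1 := by
    have := Turing.PartrecToTM2.length_trNat_le n
    rw [Turing.TM2to1.length_trInit]
    simp [Turing.PartrecToTM2.trList]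
    omega
  have := Nat.mul_le_mul_left w hlen
  rw [hl]
  nlinarith

/-- Non-computability of the output count: no computable function agrees, on all `k ≥ 1`,
with the number of distinct strings `s` with `m_k(s) > 0`. -/
theorem outputCount_not_computable :
    ¬ ∃ f : ℕ → ℕ, Computable f ∧ ∀ k, 1 ≤ k → f k = outputCount k := by
  rintro ⟨f, hf, hfk⟩
  obtain ⟨g, hg, hgk⟩ := exists_computable_bound hf hfk
  have hsq : Computable fun n => g (n * n) :=
    hg.comp (Primrec.nat_mul.comp .id .id).to_comp
  obtain ⟨a, ha⟩ := exists_long_output hsq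
  obtain ⟨N, hN, hNa, τ, s, hs, hlt⟩ := ha (2 * a + 1)
  have hle : N ≤ (2 * a + 1) * (2 * a + 1) := hNa.trans (by nlinarith)
  exact hlt.not_ge (hgk _ N hN hle τ false s hs)
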